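/- Let θ > 0, let n be a positive integer, let α ∈ (0,1), and let μ = Measure.pi (fun _ : Fin (n+1) => Unif(−θ, θ)) be the law of n+1 i.i.d. Unif(−θ,θ) samples. Define w̄(w) = max_{i ∈ Fin n} |w i| over the first n samples, and the random interval Ŵ(w) = [−w̄(w)·α^{−1/n}, w̄(w)·α^{−1/n}]. Then the probability that the fresh sample falls outside the learned support estimate satisfies μ({w | w n ∉ Ŵ(w)}) ≤ α. -/

import Mathlib

open MeasureTheory

/-- `unif a b` is the uniform probability measure on the interval `[a, b]`:
`(b - a)⁻¹` times Lebesgue measure restricted to `[a, b]`. -/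
noncomputable def unif (a b : ℝ) : Measure ℝ :=
  (ENNReal.ofReal (b - a))⁻¹ • volume.restrict (Set.Icc a b)

lemma isProbabilityMeasure_unif {a b : ℝ} (hab : a < b) : IsProbabilityMeasure (unif a b) := by
  constructor
  have h : ENNReal.ofReal (b - a) ≠ 0 := by simpa using hab
  simp [unif, ENNReal.inv_mul_cancel h ENNReal.ofReal_ne_top]

lemma unif_compl_Icc (a b : ℝ) : unif a b (Set.Icc a b)ᶜ = 0 := by
  simp [unif]

/-- A centred interval of radius `θ * t` has mass at most `t` under `Unif(-θ, θ)`. -/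
lemma unif_Ioo_le {θ : ℝ} (hθ : 0 < θ) (t : ℝ) :
    unif (-θ) θ (Set.Ioo (-(θ * t)) (θ * t)) ≤ ENNReal.ofReal t := by
  have h : ENNReal.ofReal (θ - -θ) ≠ 0 := by simpa using hθ
  have hvol : volume (Set.Ioo (-(θ * t)) (θ * t)) =
      ENNReal.ofReal (θ - -θ) * ENNReal.ofReal t := by
    rw [Real.volume_Ioo, ← ENNReal.ofReal_mul (by linarith)]
    congr 1
    ring
  calc unif (-θ) θ (Set.Ioo (-(θ * t)) (θ * t))
      ≤ (ENNReal.ofReal (θ - -θ))⁻¹ * volume (Set.Ioo (-(θ * t)) (θ * t)) := by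
        simp only [unif, Measure.smul_apply, smul_eq_mul]
        gcongr
        exact Measure.restrict_le_self
    _ = ENNReal.ofReal t := by
        rw [hvol, ← mul_assoc, ENNReal.inv_mul_cancel h ENNReal.ofReal_ne_top, one_mul]

/-- **Disturbance Support Failure bound (one-dimensional).** Given `n + 1` i.i.d.
`Unif(-θ, θ)` samples, let `w̄ = max_{i < n} |w i|` be the maximum over the first `n`
samples and `Ŵ(w) = [-w̄ · α^{-1/n}, w̄ · α^{-1/n}]`. The probability that the fresh
`(n+1)`-st sample falls outside `Ŵ(w)` is at most `α`. -/
theorem uniform_support_failure_bound (θ : ℝ) (hθ : 0 < θ) (n : ℕ) (hn : 0 < n)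
    (α : ℝ) (hα : α ∈ Set.Ioo (0 : ℝ) 1) :
    (Measure.pi fun _ : Fin (n + 1) => unif (-θ) θ)
      {w : Fin (n + 1) → ℝ |
        w (Fin.last n) ∉
          Set.Icc (-((⨆ i : Fin n, |w i.castSucc|) * α ^ (-1 / (n : ℝ))))
            ((⨆ i : Fin n, |w i.castSucc|) * α ^ (-1 / (n : ℝ)))} ≤
      ENNReal.ofReal α := by
  have hprob := isProbabilityMeasure_unif (a := -θ) (b := θ) (by linarith)
  set t : ℝ := α ^ (n : ℝ)⁻¹ with ht
  have ht0 : 0 < t := Real.rpow_pos_of_pos hα.1 _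
  have hc : α ^ (-1 / (n : ℝ)) = t⁻¹ := by
    rw [ht, ← Real.rpow_neg hα.1.le]
    congr 1
    ring
  have htn : t ^ n = α := Real.rpow_inv_natCast_pow hα.1.le hn.ne'
  -- If `θ * t ≤ w̄`, then `Ŵ(w)` contains the whole support `[-θ, θ]`.
  let small : Fin (n + 1) → Set ℝ :=
    Fin.snoc (α := fun _ => Set ℝ) (fun _ => Set.Ioo (-(θ * t)) (θ * t)) Set.univ
  let outside : Fin (n + 1) → Set ℝ :=
    Fin.snoc (α := fun _ => Set ℝ) (fun _ => Set.univ) (Set.Icc (-θ) θ)ᶜ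
  have hsub : {w : Fin (n + 1) → ℝ |
        w (Fin.last n) ∉
          Set.Icc (-((⨆ i : Fin n, |w i.castSucc|) * α ^ (-1 / (n : ℝ))))
            ((⨆ i : Fin n, |w i.castSucc|) * α ^ (-1 / (n : ℝ)))} ⊆
      Set.univ.pi small ∪ Set.univ.pi outside := by
    intro w hw
    rw [Set.mem_ofPred_eq, hc] at hw
    by_cases hlast : w (Fin.last n) ∈ Set.Icc (-θ) θ
    · left
      have hmax : (⨆ i : Fin n, |w i.castSucc|) < θ * t := by
        by_contra! hle
        have hθle : θ ≤ (⨆ i : Fin n, |w i.castSucc|) * t⁻¹ := by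
          rwa [← div_eq_mul_inv, le_div_iff₀ ht0]
        exact hw ⟨by linarith [hlast.1], by linarith [hlast.2]⟩
      intro i _
      induction i using Fin.lastCases with
      | last => simp [small]
      | cast i =>
        have hi : |w i.castSucc| < θ * t :=
          (le_ciSup (f := fun i : Fin n => |w i.castSucc|)
            (Set.finite_range _).bddAbove i).trans_lt hmax
        simpa [small] using abs_lt.mp hi
    · right
      intro i _
      induction i using Fin.lastCases with
      | last => simpa [outside] using hlast
      | cast i => simp [outside]
  have hsmall : (Measure.pi fun _ : Fin (n + 1) => unif (-θ) θ) (Set.univ.pi small) ≤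
      ENNReal.ofReal α := by
    rw [Measure.pi_pi, Fin.prod_univ_castSucc]
    simp only [small, Fin.snoc_castSucc, Fin.snoc_last, measure_univ, mul_one,
      Finset.prod_const, Finset.card_univ, Fintype.card_fin]
    rw [← htn, ENNReal.ofReal_pow ht0.le]
    gcongr
    exact unif_Ioo_le hθ t
  have houtside : (Measure.pi fun _ : Fin (n + 1) => unif (-θ) θ) (Set.univ.pi outside) = 0 := by
    rw [Measure.pi_pi, Fin.prod_univ_castSucc]
    simp [outside, unif_compl_Icc]
  calc _ ≤ _ := measure_mono hsub
    _ ≤ _ := measure_union_le _ _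
    _ ≤ ENNReal.ofReal α := by rwa [houtside, add_zero]
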